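/- arXiv:2306.08153 — 3 statements merged into one kernel-verified Lean document; each statement's English description precedes it below -/
import Mathlib

section
/- Let C ∈ ℝ^{n×n}, set X = CᵀC, and let π ⊆ {1,…,n}. For any d ≥ 1 and any u ∈ ℝ^{n×d} whose rows indexed outside π are zero and whose every row has Euclidean norm at most 1, ‖C u‖_F² ≤ Σ_{i∈π} Σ_{j∈π} |X[i,j]|. -/
open Matrix

/-- For `X = Cᵀ C` and any contribution matrix `u` supported on a
pattern `π` with rows of norm at most `1`,
`‖C u‖_F² ≤ Σ_{i∈π} Σ_{j∈π} |X i j|`. -/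
theorem frobenius_sq_le_abs_sum {n d : ℕ} (hd : 0 < d)
    (C : Matrix (Fin n) (Fin n) ℝ) (π : Finset (Fin n))
    (u : Matrix (Fin n) (Fin d) ℝ)
    (hzero : ∀ i : Fin n, i ∉ π → ∀ j : Fin d, u i j = 0)
    (hrows : ∀ i : Fin n, ∑ j : Fin d, (u i j) ^ 2 ≤ 1) :
    ∑ i : Fin n, ∑ j : Fin d, ((C * u) i j) ^ 2 ≤
      ∑ i ∈ π, ∑ j ∈ π, |(Cᵀ * C) i j| := by
  have h1 : ∀ i j, (C * u) i j = ∑ a ∈ π, C i a * u a j := by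
    intro i j
    rw [Matrix.mul_apply]
    symm
    apply Finset.sum_subset (Finset.subset_univ π)
    intro a _ ha
    rw [hzero a ha j, mul_zero]
  have h2 : ∑ i : Fin n, ∑ j : Fin d, ((C * u) i j) ^ 2 =
      ∑ a ∈ π, ∑ b ∈ π, (Cᵀ * C) a b * ∑ j, u a j * u b j := by
    have h3 : ∀ i j, ((C * u) i j) ^ 2 =
        ∑ a ∈ π, ∑ b ∈ π, (C i a * C i b) * (u a j * u b j) := by
      intro i j
      rw [h1, sq, Finset.sum_mul_sum]
      refine Finset.sum_congr rfl fun a _ => Finset.sum_congr rfl fun b _ => ?_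
      ring
    have h4 : ∀ a b, (Cᵀ * C) a b * ∑ j, u a j * u b j =
        ∑ i, ∑ j, (C i a * C i b) * (u a j * u b j) := by
      intro a b
      rw [Matrix.mul_apply, Finset.sum_mul_sum]
      rfl
    simp only [h3, h4]
    calc _ = ∑ i : Fin n, ∑ a ∈ π, ∑ b ∈ π, ∑ j : Fin d,
          (C i a * C i b) * (u a j * u b j) := by
          refine Finset.sum_congr rfl fun i _ => ?_
          rw [Finset.sum_comm]
          refine Finset.sum_congr rfl fun a _ => ?_
          rw [Finset.sum_comm]
      _ = _ := by
          rw [Finset.sum_comm]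
          refine Finset.sum_congr rfl fun a _ => ?_
          rw [Finset.sum_comm]
  rw [h2]
  refine Finset.sum_le_sum fun a _ => Finset.sum_le_sum fun b _ => ?_
  have h5 : |∑ j, u a j * u b j| ≤ 1 := by
    rw [← sq_le_one_iff_abs_le_one]
    calc _ ≤ (∑ j, u a j ^ 2) * ∑ j, u b j ^ 2 :=
          Finset.sum_mul_sq_le_sq_mul_sq _ _ _
      _ ≤ 1 := mul_le_one₀ (hrows a) (Finset.sum_nonneg fun j _ => sq_nonneg _) (hrows b)
  calc _ ≤ |(Cᵀ * C) a b * ∑ j, u a j * u b j| := le_abs_self _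
    _ = |(Cᵀ * C) a b| * |∑ j, u a j * u b j| := abs_mul _ _
    _ ≤ _ := mul_le_of_le_one_right (abs_nonneg _) h5
end

section
/- Let C ∈ ℝ^{n×n}, set X = CᵀC, and let π ⊆ {1,…,n}. Suppose the submatrix of X indexed by π is entrywise nonnegative, i.e., X[i,j] ≥ 0 for all i, j ∈ π. Then for any d ≥ 1, the supremum of ‖C u‖_F² over matrices u ∈ ℝ^{n×d} whose rows outside π are zero and whose rows have Euclidean norm at most 1 equals Σ_{i∈π} Σ_{j∈π} X[i,j]; the supremum is attained by the matrix u whose rows indexed by π all equal a fixed unit vector and whose other rows are zero. -/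
open Matrix

theorem frob_aux {n d : ℕ} (C : Matrix (Fin n) (Fin n) ℝ) (π : Finset (Fin n))
    (u : Matrix (Fin n) (Fin d) ℝ) (hu : ∀ i : Fin n, i ∉ π → ∀ j : Fin d, u i j = 0) :
    ∑ i : Fin n, ∑ j : Fin d, ((C * u) i j) ^ 2 =
      ∑ a ∈ π, ∑ b ∈ π, (Cᵀ * C) a b * ∑ j : Fin d, u a j * u b j := by
  have h1 : ∀ i j, (C * u) i j = ∑ a ∈ π, C i a * u a j := by
    intro i j
    rw [Matrix.mul_apply]
    symm
    apply Finset.sum_subset (Finset.subset_univ _)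
    intro a _ ha
    rw [hu a ha j, mul_zero]
  have h2 : ∀ i j, ((C * u) i j) ^ 2 =
      ∑ a ∈ π, ∑ b ∈ π, (C i a * u a j) * (C i b * u b j) := by
    intro i j
    rw [h1, sq, Finset.sum_mul_sum]
  have h3 : ∀ a b, (Cᵀ * C) a b * ∑ j : Fin d, u a j * u b j =
      ∑ i : Fin n, ∑ j : Fin d, (C i a * u a j) * (C i b * u b j) := by
    intro a b
    rw [Matrix.mul_apply, Finset.sum_mul_sum]
    refine Finset.sum_congr rfl fun i _ => Finset.sum_congr rfl fun j _ => ?_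
    rw [Matrix.transpose_apply]
    ring
  simp only [h2, h3]
  have e1 : ∀ i : Fin n, ∑ j : Fin d, ∑ a ∈ π, ∑ b ∈ π, (C i a * u a j) * (C i b * u b j) =
      ∑ a ∈ π, ∑ b ∈ π, ∑ j : Fin d, (C i a * u a j) * (C i b * u b j) := by
    intro i
    rw [Finset.sum_comm]
    exact Finset.sum_congr rfl fun a _ => Finset.sum_comm
  simp only [e1]
  rw [Finset.sum_comm]
  exact Finset.sum_congr rfl fun a _ => Finset.sum_comm

/-- If the submatrix of `X = Cᵀ C` indexed by `π` is entrywise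
nonnegative, then the supremum of `‖C u‖_F²` over contributions `u` supported on `π` with
rows of norm at most `1` equals `Σ_{i∈π} Σ_{j∈π} X i j`, and it is attained by the matrix
whose rows indexed by `π` all equal a fixed unit vector. -/
theorem frobenius_sq_sup_of_nonneg {n d : ℕ} (hd : 0 < d)
    (C : Matrix (Fin n) (Fin n) ℝ) (π : Finset (Fin n))
    (hnonneg : ∀ i ∈ π, ∀ j ∈ π, 0 ≤ (Cᵀ * C) i j) :
    IsGreatest
      {x : ℝ | ∃ u : Matrix (Fin n) (Fin d) ℝ,
        (∀ i : Fin n, i ∉ π → ∀ j : Fin d, u i j = 0) ∧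
        (∀ i : Fin n, ∑ j : Fin d, (u i j) ^ 2 ≤ 1) ∧
        x = ∑ i : Fin n, ∑ j : Fin d, ((C * u) i j) ^ 2}
      (∑ i ∈ π, ∑ j ∈ π, (Cᵀ * C) i j) ∧
    ∀ e : Fin d → ℝ, ∑ j : Fin d, (e j) ^ 2 = 1 →
      ∑ i : Fin n, ∑ j : Fin d,
          ((C * Matrix.of (fun i j => if i ∈ π then e j else 0)) i j) ^ 2 =
        ∑ i ∈ π, ∑ j ∈ π, (Cᵀ * C) i j := by
  have key : ∀ e : Fin d → ℝ, ∑ j : Fin d, (e j) ^ 2 = 1 →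
      ∑ i : Fin n, ∑ j : Fin d,
          ((C * Matrix.of (fun i j => if i ∈ π then e j else 0)) i j) ^ 2 =
        ∑ i ∈ π, ∑ j ∈ π, (Cᵀ * C) i j := by
    intro e he
    rw [frob_aux C π _ (by intro i hi j; simp [hi])]
    refine Finset.sum_congr rfl fun a ha => Finset.sum_congr rfl fun b hb => ?_
    have : ∑ j : Fin d, e j * e j = 1 := by simpa only [sq] using he
    simp only [Matrix.of_apply, ha, hb, if_true, this, mul_one]
  refine ⟨⟨?_, ?_⟩, key⟩
  · have he : ∑ j : Fin d, ((Pi.single (⟨0, hd⟩ : Fin d) (1 : ℝ) : Fin d → ℝ) j) ^ 2 = 1 := by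
      simp [Pi.single_apply]
    refine ⟨_, ?_, ?_, (key _ he).symm⟩
    · intro i hi j
      simp [hi]
    · intro i
      by_cases hi : i ∈ π
      · simp only [Matrix.of_apply, hi, if_true]
        exact he.le
      · simp [hi]
  · rintro x ⟨u, hu, hn, rfl⟩
    rw [frob_aux C π u hu]
    refine Finset.sum_le_sum fun a ha => Finset.sum_le_sum fun b hb => ?_
    have h : ∑ j : Fin d, u a j * u b j ≤ 1 := by
      have h2 : ∑ j : Fin d, u a j * u b j ≤ ∑ j : Fin d, ((u a j) ^ 2 + (u b j) ^ 2) / 2 :=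
        Finset.sum_le_sum fun j _ => by nlinarith [sq_nonneg (u a j - u b j)]
      rw [← Finset.sum_div, Finset.sum_add_distrib] at h2
      linarith [hn a, hn b]
    exact mul_le_of_le_one_right (hnonneg a ha b hb) h
end

section
/- Fix positive integers n, b, k and a vector v ∈ ℝⁿ. Define F : ℤ × ℤ → ℝ by the recursion F[i, m] = max( v_i + F[i+b, m−1], F[i+1, m] ) for 1 ≤ i ≤ n and 1 ≤ m ≤ k, with the convention that F[s, t] = 0 whenever s > n or t ≤ 0. Then F[1, k] = max over all subsets π ⊆ {1,…,n} with min-separation at least b and |π| ≤ k (including the empty set) of Σ_{i∈π} v_i. -/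
/-- The dynamic program `VecSens`: `F i m = max (v i + F (i+b) (m-1)) (F (i+1) m)` for
`1 ≤ i ≤ n` and `m ≥ 1`, with `F i m = 0` whenever `i > n` or `m = 0`. -/
noncomputable def vecSensF (n b : ℕ) (v : ℕ → ℝ) : ℕ → ℕ → ℝ :=
  fun i m =>
    if h : n < i ∨ m = 0 then 0
    else max (v i + vecSensF n b v (i + b) (m - 1)) (vecSensF n b v (i + 1) m)
  termination_by i m => (m, n + 1 - i)
  decreasing_by
  · exact Prod.Lex.left _ _ (by omega)
  · exact Prod.Lex.right _ (by omega)

theorem vecSensF_aux (n b : ℕ) (hb : 0 < b) (v : ℕ → ℝ) (d : ℕ) :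
    ∀ i m : ℕ, n + 1 - i ≤ d → IsGreatest
      {x : ℝ | ∃ π : Finset ℕ, π ⊆ Finset.Icc i n ∧
        (∀ i ∈ π, ∀ j ∈ π, i ≠ j → (b : ℤ) ≤ |(i : ℤ) - (j : ℤ)|) ∧
        π.card ≤ m ∧ x = ∑ i ∈ π, v i}
      (vecSensF n b v i m) := by
  induction d with
  | zero =>
    intro i m hd
    have hi : n < i := by omega
    rw [vecSensF, dif_pos (Or.inl hi)]
    refine ⟨⟨∅, by simp⟩, ?_⟩
    rintro x ⟨π, h1, -, -, rfl⟩
    rw [Finset.Icc_eq_empty (by omega), Finset.subset_empty] at h1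
    simp [h1]
  | succ d ih =>
    intro i m hd
    by_cases h : n < i ∨ m = 0
    · rw [vecSensF, dif_pos h]
      refine ⟨⟨∅, by simp⟩, ?_⟩
      rintro x ⟨π, h1, -, h3, rfl⟩
      have : π = ∅ := by
        rcases h with h | h
        · rwa [Finset.Icc_eq_empty (by omega), Finset.subset_empty] at h1
        · exact Finset.card_eq_zero.mp (by omega)
      simp [this]
    · rw [vecSensF, dif_neg h]
      push Not at h
      obtain ⟨hin, hm⟩ := h
      have A := ih (i + b) (m - 1) (by omega)
      have B := ih (i + 1) m (by omega)
      constructor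
      · rcases max_choice (v i + vecSensF n b v (i + b) (m - 1)) (vecSensF n b v (i + 1) m)
          with h | h
        · rw [h]
          obtain ⟨π, h1, h2, h3, h4⟩ := A.1
          have hge : ∀ j ∈ π, i + b ≤ j ∧ j ≤ n := fun j hj => Finset.mem_Icc.mp (h1 hj)
          have hni : i ∉ π := fun hj => by have := hge i hj; omega
          refine ⟨insert i π, ?_, ?_, ?_, ?_⟩
          · intro j hj
            rw [Finset.mem_insert] at hj
            rw [Finset.mem_Icc]
            rcases hj with rfl | hj
            · omega
            · have := hge j hj
              omega
          · intro p hp q hq hpq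
            rw [Finset.mem_insert] at hp hq
            rcases hp with rfl | hp <;> rcases hq with rfl | hq
            · exact absurd rfl hpq
            · have := hge q hq
              rw [le_abs]; omega
            · have := hge p hp
              rw [le_abs]; omega
            · exact h2 p hp q hq hpq
          · rw [Finset.card_insert_of_notMem hni]; omega
          · rw [Finset.sum_insert hni, h4]
        · rw [h]
          obtain ⟨π, h1, h2⟩ := B.1
          exact ⟨π, h1.trans (Finset.Icc_subset_Icc_left (by omega)), h2⟩
      · rintro x ⟨π, h1, h2, h3, rfl⟩
        have hge : ∀ j ∈ π, i ≤ j ∧ j ≤ n := fun j hj => Finset.mem_Icc.mp (h1 hj)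
        by_cases hi : i ∈ π
        · refine le_trans ?_ (le_max_left _ _)
          rw [← Finset.add_sum_erase π v hi]
          gcongr
          refine A.2 ⟨π.erase i, ?_, ?_, ?_, rfl⟩
          · intro j hj
            rw [Finset.mem_erase] at hj
            have h5 := hge j hj.2
            have h6 := h2 j hj.2 i hi hj.1
            rw [le_abs] at h6
            rw [Finset.mem_Icc]
            omega
          · intro p hp q hq
            exact h2 p (Finset.mem_of_mem_erase hp) q (Finset.mem_of_mem_erase hq)
          · rw [Finset.card_erase_of_mem hi]; omega
        · refine le_trans ?_ (le_max_right _ _)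
          refine B.2 ⟨π, ?_, h2, h3, rfl⟩
          intro j hj
          have h5 := hge j hj
          have : j ≠ i := fun e => hi (e ▸ hj)
          rw [Finset.mem_Icc]
          omega

/-- `F[1, k]` equals the maximum of `Σ_{i∈π} v i` over all subsets
`π ⊆ {1,…,n}` with min-separation at least `b` and at most `k` elements (including the
empty set). -/
theorem vecSensF_isGreatest (n b k : ℕ) (hn : 0 < n) (hb : 0 < b) (hk : 0 < k)
    (v : ℕ → ℝ) :
    IsGreatest
      {x : ℝ | ∃ π : Finset ℕ, π ⊆ Finset.Icc 1 n ∧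
        (∀ i ∈ π, ∀ j ∈ π, i ≠ j → (b : ℤ) ≤ |(i : ℤ) - (j : ℤ)|) ∧
        π.card ≤ k ∧ x = ∑ i ∈ π, v i}
      (vecSensF n b v 1 k) := by
  exact vecSensF_aux n b hb v (n + 1 - 1) 1 k le_rfl
end
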